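/- Let m ≥ 1 and n ≥ 1. Then the following identity holds in the polynomial ring ℚ[α]: ∑_T ∏_v ((m·h_v + 1)α + 1 − h_v)/((m+1)·h_v) = (1/(mn+1)) · binom((mn+1)α, n), where the sum is over all (m+1)-ary trees T with n internal nodes, the product is over all internal nodes v of T, and h_v is the number of internal nodes of the subtree rooted at v (Du–Liu's generalization of Postnikov's identity). -/

import Mathlib

open Polynomial

/-- Plane trees: a leaf, or an internal node carrying an ordered list of subtrees. -/
inductive PT : Type
  | leaf : PT
  | node : List PT → PT

/-- `PT.IsAry a T` means that every internal node of `T` has exactly `a` (ordered)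
children, i.e. `T` is an `a`-ary tree. -/
inductive PT.IsAry (a : ℕ) : PT → Prop
  | leaf : PT.IsAry a PT.leaf
  | node (ts : List PT) : ts.length = a → (∀ t ∈ ts, PT.IsAry a t) → PT.IsAry a (PT.node ts)

mutual
/-- The number of internal nodes of a plane tree. -/
def PT.internal : PT → ℕ
  | PT.leaf => 0
  | PT.node ts => PT.internalList ts + 1

/-- The total number of internal nodes of a list of plane trees. -/
def PT.internalList : List PT → ℕ
  | [] => 0
  | t :: ts => PT.internal t + PT.internalList ts
end

mutual
/-- The product `∏_v ((m·h_v + 1)α + 1 - h_v)/((m+1)·h_v)` over all internal nodes `v`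
of a plane tree, as a polynomial in `α = X`; here `h_v` is the number of internal nodes
of the subtree rooted at `v`. -/
noncomputable def PT.term (m : ℕ) : PT → Polynomial ℚ
  | PT.leaf => 1
  | PT.node ts =>
      C ((((m + 1) * (PT.internalList ts + 1) : ℕ) : ℚ))⁻¹
          * (C (((m * (PT.internalList ts + 1) + 1 : ℕ) : ℚ)) * X
              + C (1 - ((PT.internalList ts + 1 : ℕ) : ℚ)))
        * PT.termList m ts

/-- The product of `PT.term` over a list of plane trees. -/
noncomputable def PT.termList (m : ℕ) : List PT → Polynomial ℚ
  | [] => 1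
  | t :: ts => PT.term m t * PT.termList m ts
end

section RotheHagen

variable {K : Type*} [Field K]

/-- The Rothe polynomial `x / (x + n z) * binom(x + n z, n)` in the variable `x`. -/
noncomputable def rothePoly (z : K) : ℕ → K[X]
  | 0 => 1
  | n + 1 => C (((n + 1).factorial : K)⁻¹) * X *
      (descPochhammer K n).comp (X + C (((n : K) + 1) * z - 1))

@[simp]
lemma rothePoly_zero (z : K) : rothePoly z 0 = 1 := rfl

lemma rothePoly_succ_eval (z : K) (n : ℕ) (x : K) :
    (rothePoly z (n + 1)).eval x =
      ((n + 1).factorial : K)⁻¹ * x * (descPochhammer K n).eval (x + ((n + 1) * z - 1)) := by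
  simp [rothePoly]

lemma descPochhammer_succ_eval_left (n : ℕ) (u : K) :
    (descPochhammer K (n + 1)).eval u = u * (descPochhammer K n).eval (u - 1) := by
  simp [descPochhammer_succ_left]

variable [CharZero K]

lemma rothePoly_eval_add_one (z : K) (n : ℕ) (x : K) :
    (rothePoly z (n + 1)).eval (x + 1) =
      (rothePoly z (n + 1)).eval x + (rothePoly z n).eval (x + z) := by
  cases n with
  | zero => simp [rothePoly_succ_eval, add_comm]
  | succ n =>
    have h₁ : ((n + 1).factorial : K) ≠ 0 := by exact_mod_cast (n + 1).factorial_ne_zero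
    have h₂ : (n : K) + 1 + 1 ≠ 0 := by exact_mod_cast (n + 1).succ_ne_zero
    rw [rothePoly_succ_eval, rothePoly_succ_eval, rothePoly_succ_eval,
      descPochhammer_succ_eval_left, descPochhammer_succ_eval, Nat.factorial_succ (n + 1)]
    push_cast
    rw [show x + 1 + (((n : K) + 1 + 1) * z - 1) - 1 = x + (((n : K) + 1 + 1) * z - 1) by ring,
      show x + z + (((n : K) + 1) * z - 1) = x + (((n : K) + 1 + 1) * z - 1) by ring]
    field_simp
    ring

lemma eq_of_forall_eval_add_one {p q : K[X]} (h₀ : p.eval 0 = q.eval 0)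
    (h : ∀ x, p.eval (x + 1) - p.eval x = q.eval (x + 1) - q.eval x) : p = q := by
  refine Polynomial.eq_of_infinite_eval_eq p q
    ((Set.infinite_range_of_injective (Nat.cast_injective (R := K))).mono ?_)
  rintro _ ⟨k, rfl⟩
  induction k with
  | zero => simpa using h₀
  | succ k ih =>
    have hk := h k
    simp only [Set.mem_ofPred_eq] at ih ⊢
    push_cast
    linear_combination hk + ih

/-- The Rothe–Hagen identity. -/
theorem sum_antidiagonal_rothePoly_eval_mul (z : K) (n : ℕ) (x y : K) :
    ∑ p ∈ Finset.HasAntidiagonal.antidiagonal n,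
        (rothePoly z p.1).eval x * (rothePoly z p.2).eval y =
      (rothePoly z n).eval (x + y) := by
  induction n generalizing x with
  | zero => simp
  | succ n ih =>
    have key : ∑ p ∈ Finset.HasAntidiagonal.antidiagonal (n + 1),
        rothePoly z p.1 * C ((rothePoly z p.2).eval y) = (rothePoly z (n + 1)).comp (X + C y) := by
      apply eq_of_forall_eval_add_one
      · simp [eval_finsetSum, Finset.Nat.sum_antidiagonal_succ, rothePoly_succ_eval]
      · intro x
        have hx := rothePoly_eval_add_one z n (x + y)
        have := ih (x + z)
        simp only [eval_finsetSum, Finset.Nat.sum_antidiagonal_succ, rothePoly_zero, eval_one,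
          eval_mul, eval_C, eval_comp, eval_add, eval_X, rothePoly_eval_add_one, add_mul,
          Finset.sum_add_distrib]
        rw [this, show x + 1 + y = x + y + 1 by ring, hx, add_right_comm x z y]
        ring
    simpa [eval_finsetSum] using congrArg (eval x) key

end RotheHagen

lemma rothePoly_eval_eq_descPochhammer (m n : ℕ) (x : ℚ) :
    (rothePoly (m * x) n).eval x = ((m * n + 1 : ℕ) : ℚ)⁻¹ * (n.factorial : ℚ)⁻¹ *
      (descPochhammer ℚ n).eval (((m * n + 1 : ℕ) : ℚ) * x) := by
  cases n with
  | zero => simp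
  | succ n =>
    have h : ((m : ℚ) * (n + 1) + 1) ≠ 0 := by positivity
    rw [rothePoly_succ_eval, descPochhammer_succ_eval_left]
    push_cast
    rw [show x + (((n : ℚ) + 1) * (m * x) - 1) = (m * (n + 1) + 1) * x - 1 by ring]
    field_simp

lemma rothePoly_succ_eval_eq_mul (m n : ℕ) (x : ℚ) :
    (rothePoly (m * x) (n + 1)).eval x = (((m + 1) * (n + 1) : ℕ) : ℚ)⁻¹ *
      (((m * (n + 1) + 1 : ℕ) : ℚ) * x + (1 - ((n + 1 : ℕ) : ℚ))) *
      (rothePoly (m * x) n).eval (((m + 1 : ℕ) : ℚ) * x) := by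
  have h : (m : ℚ) + 1 ≠ 0 := by positivity
  cases n with
  | zero => simp [rothePoly_succ_eval]; field_simp
  | succ n =>
    have h' : (n : ℚ) + 1 + 1 ≠ 0 := by positivity
    rw [rothePoly_succ_eval, rothePoly_succ_eval, descPochhammer_succ_eval,
      Nat.factorial_succ (n + 1)]
    push_cast
    rw [show ((m : ℚ) + 1) * x + (((n : ℚ) + 1) * (m * x) - 1) =
      x + (((n : ℚ) + 1 + 1) * (m * x) - 1) by ring]
    field_simp
    ring

namespace PT

lemma isAry_node_iff {a : ℕ} {ts : List PT} :
    IsAry a (node ts) ↔ ts.length = a ∧ ∀ t ∈ ts, IsAry a t :=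
  ⟨fun | .node _ h₁ h₂ => ⟨h₁, h₂⟩, fun h => .node ts h.1 h.2⟩

open Classical in
/-- If the weighted counts of the trees of size at most `n` are values of the Rothe polynomials,
then so are the weighted counts of the forests of size at most `n`. -/
lemma exists_finset_list_sum_eval_termList {m n : ℕ} {x : ℚ}
    (hT : ∀ i ≤ n, ∃ s : Finset PT, (∀ T, T ∈ s ↔ IsAry (m + 1) T ∧ T.internal = i) ∧
      ∑ T ∈ s, (term m T).eval x = (rothePoly (m * x) i).eval x) (k : ℕ) :
    ∀ j ≤ n, ∃ s : Finset (List PT),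
      (∀ ts, ts ∈ s ↔ ts.length = k ∧ (∀ t ∈ ts, IsAry (m + 1) t) ∧ internalList ts = j) ∧
      ∑ ts ∈ s, (termList m ts).eval x = (rothePoly (m * x) j).eval (k * x) := by
  choose! sT hsT hsumT using hT
  induction k with
  | zero =>
    intro j _
    cases j with
    | zero =>
      refine ⟨{[]}, fun ts => ?_, by simp [termList]⟩
      cases ts <;> simp [internalList]
    | succ j =>
      refine ⟨∅, fun ts => ?_, by simp [rothePoly_succ_eval]⟩
      cases ts <;> simp [internalList]
  | succ k ih =>
    choose! sL hsL hsumL using ih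
    intro j hj
    have hle : ∀ p ∈ Finset.HasAntidiagonal.antidiagonal j, p.1 ≤ n ∧ p.2 ≤ n := fun p hp => by
      have := Finset.HasAntidiagonal.mem_antidiagonal.1 hp
      omega
    have hinj : Function.Injective fun q : PT × List PT => q.1 :: q.2 := fun q r h => by
      simpa [Prod.ext_iff] using h
    refine ⟨(Finset.HasAntidiagonal.antidiagonal j).biUnion fun p =>
      (sT p.1 ×ˢ sL p.2).image fun q => q.1 :: q.2, fun ts => ?_, ?_⟩
    · simp only [Finset.mem_biUnion, Finset.mem_image, Finset.mem_product, Prod.exists]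
      constructor
      · rintro ⟨i, l, hp, t, ts, ⟨ht, hts⟩, rfl⟩
        rw [hsT i (hle _ hp).1] at ht
        rw [hsL l (hle _ hp).2] at hts
        have := Finset.HasAntidiagonal.mem_antidiagonal.1 hp
        simp only [List.length_cons, List.forall_mem_cons, internalList]
        exact ⟨by rw [hts.1], ⟨ht.1, hts.2.1⟩, by rw [ht.2, hts.2.2, this]⟩
      · rintro ⟨hlen, hary, hint⟩
        cases ts with
        | nil => simp at hlen
        | cons t ts =>
          rw [List.forall_mem_cons] at hary
          simp only [internalList] at hint
          refine ⟨t.internal, internalList ts, Finset.HasAntidiagonal.mem_antidiagonal.2 hint,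
            t, ts, ⟨(hsT _ (by omega) _).2 ⟨hary.1, rfl⟩,
              (hsL _ (by omega) _).2 ⟨by simpa using hlen, hary.2, rfl⟩⟩, rfl⟩
    · rw [Finset.sum_biUnion]
      · rw [show ((k + 1 : ℕ) : ℚ) * x = x + k * x by push_cast; ring,
          ← sum_antidiagonal_rothePoly_eval_mul]
        refine Finset.sum_congr rfl fun p hp => ?_
        rw [Finset.sum_image hinj.injOn, ← hsumT _ (hle p hp).1, ← hsumL _ (hle p hp).2,
          Finset.sum_mul_sum, Finset.sum_product]
        simp [termList]
      · intro p hp q hq hpq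
        refine Finset.disjoint_left.2 fun ts h₁ h₂ => hpq ?_
        simp only [Finset.mem_image, Finset.mem_product, Prod.exists] at h₁ h₂
        obtain ⟨t, ts, ⟨ht, hts⟩, rfl⟩ := h₁
        obtain ⟨t', ts', ⟨ht', hts'⟩, h⟩ := h₂
        obtain ⟨rfl, rfl⟩ := List.cons.inj h
        rw [hsT _ (hle _ hp).1] at ht
        rw [hsT _ (hle _ hq).1] at ht'
        rw [hsL _ (hle _ hp).2] at hts
        rw [hsL _ (hle _ hq).2] at hts'
        exact Prod.ext (ht.2.symm.trans ht'.2) (hts.2.2.symm.trans hts'.2.2)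

open Classical in
lemma exists_finset_sum_eval_term (m n : ℕ) (x : ℚ) :
    ∃ s : Finset PT, (∀ T, T ∈ s ↔ IsAry (m + 1) T ∧ T.internal = n) ∧
      ∑ T ∈ s, (term m T).eval x = (rothePoly (m * x) n).eval x := by
  induction n using Nat.strong_induction_on with
  | _ n ih =>
    cases n with
    | zero =>
      refine ⟨{leaf}, fun T => ?_, by simp [term]⟩
      cases T <;> simp [internal, IsAry.leaf]
    | succ n =>
      obtain ⟨s, hs, hsum⟩ := exists_finset_list_sum_eval_termList
        (fun i hi => ih i (Nat.lt_succ_of_le hi)) (m + 1) n le_rfl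
      refine ⟨s.image node, fun T => ?_, ?_⟩
      · cases T <;> simp [internal, isAry_node_iff, hs, and_assoc]
      · rw [Finset.sum_image fun _ _ _ _ h => node.inj h, rothePoly_succ_eval_eq_mul, ← hsum,
          Finset.mul_sum]
        refine Finset.sum_congr rfl fun ts hts => ?_
        simp only [term, ((hs ts).1 hts).2.2, eval_mul, eval_add, eval_C, eval_X]

end PT

/-- **The Du–Liu generalization of Postnikov's identity**, in `ℚ[α]`: for `m, n ≥ 1`,
`∑_T ∏_v ((m h_v + 1)α + 1 - h_v)/((m+1) h_v) = (1/(mn+1)) binom((mn+1)α, n)`, the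
(finite) sum being over all `(m+1)`-ary trees `T` with `n` internal nodes and the product
over all internal nodes `v` of `T`; `binom(x, n) = x(x-1)⋯(x-n+1)/n!`, so
`binom((mn+1)α, n)` is the descending Pochhammer polynomial of degree `n` composed with
`(mn+1)α`, divided by `n!`. -/
theorem du_liu_generalization (m n : ℕ) (hm : 1 ≤ m) (hn : 1 ≤ n) :
    ∑ᶠ T ∈ {T : PT | PT.IsAry (m + 1) T ∧ T.internal = n}, PT.term m T
      = C (((m * n + 1 : ℕ) : ℚ))⁻¹ * C ((Nat.factorial n : ℚ))⁻¹
        * (descPochhammer ℚ n).comp (C (((m * n + 1 : ℕ) : ℚ)) * X) := by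
  refine Polynomial.funext fun x => ?_
  obtain ⟨s, hs, hsum⟩ := PT.exists_finset_sum_eval_term m n x
  have hset : {T : PT | PT.IsAry (m + 1) T ∧ T.internal = n} = ↑s := by
    ext T
    simp [hs]
  rw [hset, finsum_mem_coe_finset, eval_finsetSum, hsum, rothePoly_eval_eq_descPochhammer]
  simp only [eval_mul, eval_comp, eval_C, eval_X]
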